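/- The triangle group T_{p,q,r} = ⟨x, y | x^p = y^q = (x y⁻¹)^r = 1⟩ contains a non-abelian free subgroup whenever 1/p + 1/q + 1/r < 1. -/

import Mathlib

/-- The triangle group `T_{p,q,r} = ⟨x, y | x^p = y^q = (xy⁻¹)^r = 1⟩`,
generators `x = of 0`, `y = of 1`. -/
def relsTriangle (p q r : ℕ) : Set (FreeGroup (Fin 2)) :=
  let x := FreeGroup.of (0 : Fin 2)
  let y := FreeGroup.of (1 : Fin 2)
  {x ^ p, y ^ q, (x * y⁻¹) ^ r}

open Matrix Pointwise
open scoped commutatorElement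

theorem abs_add_le_mul_abs_add {M a b c d x y : ℝ} (hM : 1 ≤ M) (h : |a| + |b| + |d| ≤ M * |c|)
    (hxy : M * |y| ≤ |x|) : |a * x + b * y| ≤ M * |c * x + d * y| := by
  have h₁ : |a * x + b * y| ≤ |a| * |x| + |b| * |y| := by
    simpa only [abs_mul] using abs_add_le (a * x) (b * y)
  have h₂ : |c| * |x| - |d| * |y| ≤ |c * x + d * y| := by
    simpa only [abs_mul, abs_neg, sub_neg_eq_add] using abs_sub_abs_le_abs_sub (c * x) (-(d * y))
  have hyx : |y| ≤ |x| := (le_mul_of_one_le_left (abs_nonneg y) hM).trans hxy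
  have h₃ := mul_le_mul_of_nonneg_right h (abs_nonneg x)
  have h₄ := mul_le_mul_of_nonneg_left hyx (abs_nonneg b)
  have h₅ := mul_le_mul_of_nonneg_left hxy (abs_nonneg d)
  have h₆ := mul_le_mul_of_nonneg_left h₂ (zero_le_one.trans hM)
  linarith

theorem mul_abs_inv_mul_lt {M L x y : ℝ} (hL : 0 < L) (hML : M ^ 2 < L ^ 2)
    (hx : x ≠ 0) (hM : 0 < M) (hxy : |y| ≤ M * |x|) : M * |L⁻¹ * y| < |L * x| := by
  rw [abs_mul, abs_mul, abs_inv, abs_of_pos hL, ← mul_assoc, mul_comm M, mul_assoc,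
    inv_mul_lt_iff₀ hL]
  have h₁ := mul_le_mul_of_nonneg_left hxy hM.le
  have h₂ := mul_lt_mul_of_pos_right hML (abs_pos.2 hx)
  linarith

theorem exists_injective_lift_of_diagonal (g : Matrix.SpecialLinearGroup (Fin 2) ℝ)
    (hg : ∀ i j, g i j ≠ 0) {l : ℝ} (hl : 1 < l) (D : Matrix.SpecialLinearGroup (Fin 2) ℝ)
    (hD : (D : Matrix (Fin 2) (Fin 2) ℝ) = !![l, 0; 0, l⁻¹]) :
    ∃ n : ℕ, Function.Injective (FreeGroup.lift ![D ^ n, g * D ^ n * g⁻¹]) := by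
  obtain ⟨M, hM, hgM⟩ : ∃ M : ℝ, 1 ≤ M ∧
      ∀ i j, |g 0 0| + |g 0 1| + |g 1 0| + |g 1 1| ≤ M * |g i j| := by
    set S := |g 0 0| + |g 0 1| + |g 1 0| + |g 1 1|
    have hS : 0 ≤ S := by positivity
    have hpos : ∀ i j, 0 ≤ S / |g i j| := fun i j => by positivity
    refine ⟨1 + ∑ i, ∑ j, S / |g i j|, ?_, fun i j => ?_⟩
    · exact le_add_of_nonneg_right (Finset.sum_nonneg fun i _ => Finset.sum_nonneg fun j _ => hpos i j)
    · rw [← div_le_iff₀ (abs_pos.2 (hg i j))]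
      refine le_add_of_nonneg_of_le zero_le_one ?_
      refine le_trans ?_ (Finset.single_le_sum
        (fun i _ => Finset.sum_nonneg fun j _ => hpos i j) (Finset.mem_univ i))
      exact Finset.single_le_sum (fun j _ => hpos i j) (Finset.mem_univ j)
  have hM0 : 0 < M := zero_lt_one.trans_le hM
  obtain ⟨n, hn⟩ := pow_unbounded_of_one_lt M hl
  refine ⟨n, ?_⟩
  set L := l ^ n with hL
  have hML : M ^ 2 < L ^ 2 := pow_lt_pow_left₀ hn hM0.le two_ne_zero
  have hL0 : 0 < L := hM0.trans hn
  obtain ⟨E, hE⟩ : ∃ E, E = D ^ n := ⟨_, rfl⟩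
  rw [← hE]
  have hEc : (E : Matrix (Fin 2) (Fin 2) ℝ) = !![L, 0; 0, L⁻¹] := by
    have hdiag : ∀ a b : ℝ, !![a, 0; 0, b] = diagonal ![a, b] := fun a b => by
      ext i j; fin_cases i <;> fin_cases j <;> simp
    rw [hE, Matrix.SpecialLinearGroup.coe_pow, hD, hdiag, diagonal_pow, hdiag]
    congr 1
    ext i
    fin_cases i <;> simp [hL]
  have hEi : ((E⁻¹ : Matrix.SpecialLinearGroup (Fin 2) ℝ) : Matrix (Fin 2) (Fin 2) ℝ) =
      !![L⁻¹, 0; 0, L] := by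
    rw [Matrix.SpecialLinearGroup.coe_inv, hEc, adjugate_fin_two_of, neg_zero]
  have smul_val : ∀ (h : Matrix.SpecialLinearGroup (Fin 2) ℝ) (v : RayVector ℝ (Fin 2 → ℝ)) (i : Fin 2),
      (h • v).1 i = h i 0 * v.1 0 + h i 1 * v.1 1 := by
    intro h v i
    change (h.1 *ᵥ v.1) i = _
    simp [mulVec, dotProduct, Fin.sum_univ_two]
  let X : Set (RayVector ℝ (Fin 2 → ℝ)) := {v | M * |v.1 1| < |v.1 0|}
  let Y : Set (RayVector ℝ (Fin 2 → ℝ)) := {v | M * |v.1 0| < |v.1 1|}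
  have hXY : Disjoint X Y := by
    rw [Set.disjoint_left]
    intro v h₁ h₂
    simp only [X, Y, Set.mem_ofPred_eq] at h₁ h₂
    have := le_mul_of_one_le_left (abs_nonneg (v.1 0)) hM
    have := le_mul_of_one_le_left (abs_nonneg (v.1 1)) hM
    linarith
  have hEX : ∀ v ∉ Y, E • v ∈ X := by
    intro v hv
    simp only [Y, Set.mem_ofPred_eq, not_lt] at hv
    have hv0 : v.1 0 ≠ 0 := by
      intro h0
      refine v.2 (funext fun i => ?_)
      fin_cases i
      · exact h0
      · simpa [h0] using hv
    simpa [X, smul_val, hEc] using mul_abs_inv_mul_lt hL0 hML hv0 hM0 hv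
  have hEY : ∀ v ∉ X, E⁻¹ • v ∈ Y := by
    intro v hv
    simp only [X, Set.mem_ofPred_eq, not_lt] at hv
    have hv0 : v.1 1 ≠ 0 := by
      intro h0
      refine v.2 (funext fun i => ?_)
      fin_cases i
      · simpa [h0] using hv
      · exact h0
    simp only [Y, Set.mem_ofPred_eq, smul_val, hEi]
    simpa using mul_abs_inv_mul_lt hL0 hML hv0 hM0 hv
  have hgXY : ∀ v ∈ X ∪ Y, g • v ∉ X ∪ Y := by
    have h₀ := abs_nonneg (g 0 0)
    have h₁ := abs_nonneg (g 0 1)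
    have h₂ := abs_nonneg (g 1 0)
    have h₃ := abs_nonneg (g 1 1)
    rintro v (hv | hv) (h | h) <;>
      simp only [X, Y, Set.mem_ofPred_eq, smul_val] at hv h <;> refine h.not_ge ?_
    · exact abs_add_le_mul_abs_add hM (by linarith [hgM 1 0]) hv.le
    · exact abs_add_le_mul_abs_add hM (by linarith [hgM 0 0]) hv.le
    · rw [add_comm, add_comm (g 1 0 * _)]
      exact abs_add_le_mul_abs_add hM (by linarith [hgM 1 1]) hv.le
    · rw [add_comm, add_comm (g 0 0 * _)]
      exact abs_add_le_mul_abs_add hM (by linarith [hgM 0 1]) hv.le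
  have hdisj : ∀ S ⊆ X ∪ Y, ∀ T ⊆ X ∪ Y, Disjoint S (g • T) := by
    intro S hS T hT
    rw [Set.disjoint_left]
    rintro _ hvS ⟨w, hw, rfl⟩
    exact hgXY w (hT hw) (hS hvS)
  have hX' : X ⊆ X ∪ Y := Set.subset_union_left
  have hY' : Y ⊆ X ∪ Y := Set.subset_union_right
  refine FreeGroup.injective_lift_of_ping_pong _ ![X, g • X] ![Y, g • Y] ?_ ?_ ?_ ?_ ?_ ?_
  · have : X.Nonempty := ⟨⟨![1, 0], by simp⟩, show M * |(0 : ℝ)| < |(1 : ℝ)| by simp⟩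
    intro i
    fin_cases i
    · exact this
    · exact this.smul_set
  · intro i j hij
    fin_cases i <;> fin_cases j
    · exact absurd rfl hij
    · exact hdisj X hX' X hX'
    · exact (hdisj X hX' X hX').symm
    · exact absurd rfl hij
  · intro i j hij
    fin_cases i <;> fin_cases j
    · exact absurd rfl hij
    · exact hdisj Y hY' Y hY'
    · exact (hdisj Y hY' Y hY').symm
    · exact absurd rfl hij
  · intro i j
    fin_cases i <;> fin_cases j
    · exact hXY
    · exact hdisj X hX' Y hY'
    · exact (hdisj Y hY' X hX').symm
    · exact Set.disjoint_smul_set.2 hXY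
  · intro i
    fin_cases i
    · rintro _ ⟨v, hv, rfl⟩
      exact hEX v hv
    · rintro _ ⟨v, hv, rfl⟩
      refine ⟨E • g⁻¹ • v, hEX _ fun h => hv ⟨_, h, smul_inv_smul g v⟩, ?_⟩
      simp [mul_smul]
  · intro i
    fin_cases i
    · rintro _ ⟨v, hv, rfl⟩
      exact hEY v hv
    · rintro _ ⟨v, hv, rfl⟩
      refine ⟨E⁻¹ • g⁻¹ • v, hEY _ fun h => hv ⟨_, h, smul_inv_smul g v⟩, ?_⟩
      simp [mul_smul]

theorem exists_one_lt_add_inv_eq {t : ℝ} (ht : 2 < t) : ∃ l : ℝ, 1 < l ∧ l + l⁻¹ = t := by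
  have hs : 0 ≤ t ^ 2 - 4 := by nlinarith
  have hsq := Real.sq_sqrt hs
  have hs0 := Real.sqrt_nonneg (t ^ 2 - 4)
  refine ⟨(t + √(t ^ 2 - 4)) / 2, by linarith, ?_⟩
  have : t + √(t ^ 2 - 4) ≠ 0 := by positivity
  field_simp
  linear_combination hsq

theorem exists_conj_diagonal (A : Matrix.SpecialLinearGroup (Fin 2) ℝ)
    (hA : 2 < (A : Matrix (Fin 2) (Fin 2) ℝ).trace) :
    ∃ l : ℝ, 1 < l ∧ ∃ P D : Matrix.SpecialLinearGroup (Fin 2) ℝ,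
      (D : Matrix (Fin 2) (Fin 2) ℝ) = !![l, 0; 0, l⁻¹] ∧ A = P * D * P⁻¹ := by
  obtain ⟨l, hl, hlA⟩ : ∃ l : ℝ, 1 < l ∧ l + l⁻¹ = (A : Matrix (Fin 2) (Fin 2) ℝ).trace :=
    exists_one_lt_add_inv_eq hA
  have hl0 : l ≠ 0 := by positivity
  have hlm : l ≠ l⁻¹ := by
    have := inv_lt_one_of_one_lt₀ hl
    linarith
  have hdet := A.det_coe
  rw [trace_fin_two] at hlA
  rw [det_fin_two] at hdet
  have eig : ∀ m : ℝ, m ≠ 0 → m + m⁻¹ = A 0 0 + A 1 1 →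
      ∃ v : Fin 2 → ℝ, v ≠ 0 ∧ A.1 *ᵥ v = m • v := by
    intro m hm hmA
    have : (A.1 - m • (1 : Matrix (Fin 2) (Fin 2) ℝ)).det = 0 := by
      have : m * (A 0 0 + A 1 1) = m ^ 2 + 1 := by rw [← hmA]; field_simp
      simp [det_fin_two]
      linear_combination hdet - this
    obtain ⟨v, hv, h⟩ := exists_mulVec_eq_zero_iff.2 this
    refine ⟨v, hv, ?_⟩
    rw [sub_mulVec, sub_eq_zero, smul_mulVec, one_mulVec] at h
    exact h
  obtain ⟨v, hv, hAv⟩ := eig l hl0 hlA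
  obtain ⟨u, hu, hAu⟩ := eig l⁻¹ (inv_ne_zero hl0) (by rw [inv_inv, add_comm]; exact hlA)
  have hv0 := congrFun hAv 0
  have hv1 := congrFun hAv 1
  have hu0 := congrFun hAu 0
  have hu1 := congrFun hAu 1
  simp [mulVec, dotProduct, Fin.sum_univ_two] at hv0 hv1 hu0 hu1
  have hd : v 0 * u 1 - u 0 * v 1 ≠ 0 := by
    intro hd
    have key : ∀ i j, v i * u j = 0 := by
      intro i j
      refine (mul_eq_zero.1 (?_ : (l - l⁻¹) * (v i * u j) = 0)).resolve_left (sub_ne_zero.2 hlm)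
      fin_cases i <;> fin_cases j <;> simp only [Fin.zero_eta, Fin.mk_one, Fin.isValue]
      · linear_combination -u 0 * hv0 + v 0 * hu0 - A 0 1 * hd
      · linear_combination -u 1 * hv0 + v 1 * hu0 + (A 0 0 - l⁻¹) * hd
      · linear_combination -u 0 * hv1 + v 0 * hu1 - (A 1 1 - l⁻¹) * hd
      · linear_combination -u 1 * hv1 + v 1 * hu1 + A 1 0 * hd
    obtain ⟨i, hi⟩ := Function.ne_iff.1 hv
    obtain ⟨j, hj⟩ := Function.ne_iff.1 hu
    exact mul_ne_zero hi hj (key i j)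
  set d := v 0 * u 1 - u 0 * v 1 with hd_def
  let P : Matrix.SpecialLinearGroup (Fin 2) ℝ := ⟨!![v 0, u 0 / d; v 1, u 1 / d], by
    rw [det_fin_two_of, mul_div_assoc', div_mul_eq_mul_div, ← sub_div, ← hd_def, div_self hd]⟩
  let D : Matrix.SpecialLinearGroup (Fin 2) ℝ := ⟨!![l, 0; 0, l⁻¹], by
    rw [det_fin_two_of, mul_inv_cancel₀ hl0, mul_zero, sub_zero]⟩
  refine ⟨l, hl, P, D, rfl, eq_mul_inv_of_mul_eq ?_⟩
  ext i j
  rw [Matrix.SpecialLinearGroup.coe_mul, Matrix.SpecialLinearGroup.coe_mul, Matrix.mul_apply,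
    Matrix.mul_apply, Fin.sum_univ_two, Fin.sum_univ_two]
  fin_cases i <;> fin_cases j <;> simp [P, D]
  · linear_combination hv0
  · linear_combination d⁻¹ * hu0
  · linear_combination hv1
  · linear_combination d⁻¹ * hu1

theorem trace_inv_eq (A : Matrix.SpecialLinearGroup (Fin 2) ℝ) :
    ((A⁻¹ : Matrix.SpecialLinearGroup (Fin 2) ℝ) : Matrix (Fin 2) (Fin 2) ℝ).trace =
      (A : Matrix (Fin 2) (Fin 2) ℝ).trace := by
  rw [Matrix.SpecialLinearGroup.coe_inv, adjugate_fin_two, trace_fin_two_of, trace_fin_two,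
    add_comm]

theorem trace_inv_mul_mul (P A : Matrix.SpecialLinearGroup (Fin 2) ℝ) :
    ((P⁻¹ * A * P : Matrix.SpecialLinearGroup (Fin 2) ℝ) : Matrix (Fin 2) (Fin 2) ℝ).trace =
      (A : Matrix (Fin 2) (Fin 2) ℝ).trace := by
  rw [mul_assoc, Matrix.SpecialLinearGroup.coe_mul, trace_mul_comm,
    ← Matrix.SpecialLinearGroup.coe_mul, mul_inv_cancel_right]

theorem mul_self_eq_trace_smul_sub_one (A : Matrix.SpecialLinearGroup (Fin 2) ℝ) :
    A.1 * A.1 = A.1.trace • A.1 - 1 := by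
  have h := A.det_coe
  rw [det_fin_two] at h
  ext i j
  rw [Matrix.mul_apply, Fin.sum_univ_two, trace_fin_two]
  fin_cases i <;> fin_cases j <;> simp
  · linear_combination -h
  · ring
  · ring
  · linear_combination -h

theorem trace_mul_commutator (A B : Matrix.SpecialLinearGroup (Fin 2) ℝ) :
    (A * ⁅A, B⁆).1.trace = A.1.trace * (⁅A, B⁆.1.trace - 1) := by
  have h : (A * ⁅A, B⁆).1 =
      A.1.trace • ⁅A, B⁆.1 - (B⁻¹⁻¹ * A⁻¹ * B⁻¹ : Matrix.SpecialLinearGroup (Fin 2) ℝ).1 := by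
    simp only [commutatorElement_def, inv_inv, mul_assoc]
    rw [Matrix.SpecialLinearGroup.coe_mul, Matrix.SpecialLinearGroup.coe_mul, ← Matrix.mul_assoc,
      mul_self_eq_trace_smul_sub_one, sub_mul, one_mul, smul_mul]
  rw [h, trace_sub, trace_smul, trace_inv_mul_mul, trace_inv_eq, smul_eq_mul]
  ring

theorem exists_injective_lift_of_trace (A g : Matrix.SpecialLinearGroup (Fin 2) ℝ)
    (hA : 2 < A.1.trace) (hg : g.1.trace ≠ 0) (hg' : g.1.trace ^ 2 < 4)
    (hgA : (g * A).1.trace = g.1.trace * (A.1.trace - 1)) :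
    ∃ n : ℕ, Function.Injective (FreeGroup.lift ![A ^ n, g * A ^ n * g⁻¹]) := by
  obtain ⟨l, hl, P, D, hD, rfl⟩ := exists_conj_diagonal A hA
  set k := P⁻¹ * g * P with hk
  have htD : (P * D * P⁻¹).1.trace = D.1.trace := by
    simpa using trace_inv_mul_mul P⁻¹ D
  have htg : g.1.trace = k.1.trace := (trace_inv_mul_mul P g).symm
  have htkD : (g * (P * D * P⁻¹)).1.trace = (k * D).1.trace := by
    rw [← trace_inv_mul_mul P (g * (P * D * P⁻¹))]
    simp [hk, mul_assoc]
  rw [htkD, htg, htD, Matrix.SpecialLinearGroup.coe_mul, hD, trace_fin_two, trace_fin_two,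
    trace_fin_two_of, Matrix.mul_apply, Matrix.mul_apply, Fin.sum_univ_two, Fin.sum_univ_two] at hgA
  rw [htg, trace_fin_two] at hg hg'
  simp at hgA
  have hdet := k.det_coe
  rw [det_fin_two] at hdet
  have hl0 : 0 < l := zero_lt_one.trans hl
  have h₁ : k 0 0 = l * k 1 1 := by
    have h : (l - 1) * (k 0 0 - l * k 1 1) = 0 := by
      field_simp at hgA
      linear_combination hgA
    exact sub_eq_zero.1 ((mul_eq_zero.1 h).resolve_left (sub_ne_zero.2 hl.ne'))
  have h11 : k 1 1 ≠ 0 := by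
    intro h
    simp [h₁, h] at hg
  have h00 : k 0 0 ≠ 0 := by
    rw [h₁]
    exact mul_ne_zero hl0.ne' h11
  have hne : k 0 1 * k 1 0 ≠ 0 := by
    intro h
    nlinarith [sq_nonneg (k 0 0 - k 1 1)]
  obtain ⟨n, hn⟩ := exists_injective_lift_of_diagonal k (by
    intro i j
    fin_cases i <;> fin_cases j
    exacts [h00, left_ne_zero_of_mul hne, right_ne_zero_of_mul hne, h11]) hl D hD
  refine ⟨n, ?_⟩
  have : FreeGroup.lift ![(P * D * P⁻¹) ^ n, g * (P * D * P⁻¹) ^ n * g⁻¹] =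
      (MulAut.conj P).toMonoidHom.comp (FreeGroup.lift ![D ^ n, k * D ^ n * k⁻¹]) := by
    ext i : 1
    fin_cases i
    · simp [conj_pow]
    · simp only [Fin.mk_one, conj_pow]
      simp [hk, mul_assoc]
  rw [this]
  exact (MulAut.conj P).injective.comp hn

theorem sq_eq_one_of_mem_center {A : Matrix.SpecialLinearGroup (Fin 2) ℝ}
    (hA : A ∈ Subgroup.center (Matrix.SpecialLinearGroup (Fin 2) ℝ)) : A ^ 2 = 1 := by
  obtain ⟨r, hr, h⟩ := Matrix.SpecialLinearGroup.mem_center_iff.1 hA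
  apply Subtype.ext
  rw [Matrix.SpecialLinearGroup.coe_pow, ← h, ← map_pow, ← Fintype.card_fin 2, hr, map_one]
  rfl

theorem exists_injective_of_trace_commutator {T : Type*} [Group T]
    (φ : T →* Matrix.SpecialLinearGroup (Fin 2) ℝ ⧸ Subgroup.center _) {x y : T}
    {A B : Matrix.SpecialLinearGroup (Fin 2) ℝ} (hx : φ x = A) (hy : φ y = B)
    (hAB : 2 < ⁅A, B⁆.1.trace) (hA : A.1.trace ≠ 0) (hA' : A.1.trace ^ 2 < 4) :
    ∃ f : FreeGroup (Fin 2) →* T, Function.Injective f := by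
  obtain ⟨n, hn⟩ := exists_injective_lift_of_trace ⁅A, B⁆ A hAB hA hA' (trace_mul_commutator A B)
  set F := FreeGroup.lift ![⁅A, B⁆ ^ n, A * ⁅A, B⁆ ^ n * A⁻¹] with hF
  refine ⟨FreeGroup.lift ![⁅x, y⁆ ^ n, x * ⁅x, y⁆ ^ n * x⁻¹],
    (injective_iff_map_eq_one _).2 fun z hz => ?_⟩
  have hφ : φ.comp (FreeGroup.lift ![⁅x, y⁆ ^ n, x * ⁅x, y⁆ ^ n * x⁻¹]) =
      (QuotientGroup.mk' _).comp F := by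
    ext i : 1
    fin_cases i <;> simp [hF, hx, hy, commutatorElement_def]
  have hFz : F z ∈ Subgroup.center (Matrix.SpecialLinearGroup (Fin 2) ℝ) := by
    have := DFunLike.congr_fun hφ z
    rw [MonoidHom.comp_apply, hz, map_one] at this
    exact (QuotientGroup.eq_one_iff _).1 this.symm
  have hz2 : z ^ 2 = 1 := hn (by rw [map_pow, sq_eq_one_of_mem_center hFz, map_one])
  exact (pow_eq_one_iff_left two_ne_zero).1 hz2

theorem pow_mem_center_of_trace_eq {A : Matrix.SpecialLinearGroup (Fin 2) ℝ} {θ : ℝ} {n : ℕ}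
    (hA : A.1.trace = 2 * Real.cos θ) (hθ : Real.sin θ ≠ 0) (hn : Real.sin (n * θ) = 0) :
    A ^ n ∈ Subgroup.center (Matrix.SpecialLinearGroup (Fin 2) ℝ) := by
  have key : ∀ m : ℕ, Real.sin θ • A.1 ^ m =
      Real.sin (m * θ) • A.1 - Real.sin (m * θ - θ) • (1 : Matrix (Fin 2) (Fin 2) ℝ) := by
    intro m
    induction m with
    | zero => simp
    | succ m ih =>
      have h : Real.sin ((m + 1 : ℕ) * θ) =
          Real.sin (m * θ) * (2 * Real.cos θ) - Real.sin (m * θ - θ) := by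
        rw [Nat.cast_succ, add_mul, one_mul, Real.sin_add, Real.sin_sub]
        ring
      have h' : ((m + 1 : ℕ) : ℝ) * θ - θ = m * θ := by push_cast; ring
      rw [pow_succ, ← smul_mul, ih, sub_mul, smul_mul, smul_mul, mul_self_eq_trace_smul_sub_one,
        one_mul, h', h, hA, smul_sub, smul_smul, sub_smul]
      abel
  have hs := key n
  rw [hn, zero_smul, zero_sub, ← neg_smul] at hs
  have hAn : A.1 ^ n = ((Real.sin θ)⁻¹ * -Real.sin (n * θ - θ)) •
      (1 : Matrix (Fin 2) (Fin 2) ℝ) := by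
    rw [mul_smul, ← hs, inv_smul_smul₀ hθ]
  rw [Subgroup.mem_center_iff]
  intro B
  apply Subtype.ext
  rw [Matrix.SpecialLinearGroup.coe_mul, Matrix.SpecialLinearGroup.coe_mul,
    Matrix.SpecialLinearGroup.coe_pow, hAn, smul_mul, Matrix.mul_smul, one_mul, mul_one]

theorem exists_triangle_matrices {α β γ : ℝ} (hα : 0 < α) (hβ : 0 < β) (hγ : 0 < γ)
    (h : α + β + γ < Real.pi) :
    ∃ A B : Matrix.SpecialLinearGroup (Fin 2) ℝ,
      A.1.trace = 2 * Real.cos α ∧ B.1.trace = 2 * Real.cos β ∧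
      (A * B).1.trace = -(2 * Real.cos γ) ∧ 2 < ⁅A, B⁆.1.trace := by
  have hsα : 0 < Real.sin α := Real.sin_pos_of_pos_of_lt_pi hα (by linarith)
  have hsβ : 0 < Real.sin β := Real.sin_pos_of_pos_of_lt_pi hβ (by linarith)
  have hcos : Real.sin α * Real.sin β < Real.cos α * Real.cos β + Real.cos γ := by
    have : Real.cos (Real.pi - (α + β)) < Real.cos γ :=
      Real.cos_lt_cos_of_nonneg_of_le_pi hγ.le (by linarith) (by linarith)
    rw [Real.cos_pi_sub, Real.cos_add] at this
    linarith
  obtain ⟨r, hr, hrH⟩ := exists_one_lt_add_inv_eq (t := 2 * ((Real.cos α * Real.cos β + Real.cos γ) /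
    (Real.sin α * Real.sin β))) (by
      have := (one_lt_div (mul_pos hsα hsβ)).2 hcos
      linarith)
  have hr0 : r ≠ 0 := by positivity
  have hrr : r * r⁻¹ = 1 := mul_inv_cancel₀ hr0
  have hr1 : r⁻¹ < 1 := inv_lt_one_of_one_lt₀ hr
  have hH : Real.sin α * Real.sin β * (r + r⁻¹) = 2 * (Real.cos α * Real.cos β + Real.cos γ) := by
    rw [hrH]
    field_simp
  generalize r⁻¹ = s at *
  have hα1 := Real.sin_sq_add_cos_sq α
  have hβ1 := Real.sin_sq_add_cos_sq β
  let A : Matrix.SpecialLinearGroup (Fin 2) ℝ :=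
    ⟨!![Real.cos α, -Real.sin α; Real.sin α, Real.cos α], by
      rw [det_fin_two_of]; linear_combination hα1⟩
  let B : Matrix.SpecialLinearGroup (Fin 2) ℝ :=
    ⟨!![Real.cos β, -(r * Real.sin β); s * Real.sin β, Real.cos β], by
      rw [det_fin_two_of]; linear_combination hβ1 + Real.sin β ^ 2 * hrr⟩
  refine ⟨A, B, ?_, ?_, ?_, ?_⟩
  · simp only [A, trace_fin_two_of]; ring
  · simp only [B, trace_fin_two_of]; ring
  · rw [Matrix.SpecialLinearGroup.coe_mul]
    simp only [A, B, mul_fin_two, trace_fin_two_of]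
    linear_combination -hH
  · have : ⁅A, B⁆.1.trace = 2 + (Real.sin α * Real.sin β * (r - s)) ^ 2 := by
      rw [commutatorElement_def, Matrix.SpecialLinearGroup.coe_mul,
        Matrix.SpecialLinearGroup.coe_mul, Matrix.SpecialLinearGroup.coe_mul,
        Matrix.SpecialLinearGroup.coe_inv, Matrix.SpecialLinearGroup.coe_inv]
      simp only [A, B, adjugate_fin_two_of, mul_fin_two, trace_fin_two_of]
      linear_combination 2 * (Real.sin β ^ 2 + Real.cos β ^ 2) * hα1 + 2 * hβ1 +
        2 * (Real.cos α ^ 2 + Real.sin α ^ 2) * Real.sin β ^ 2 * hrr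
    rw [this]
    have : 0 < r - s := by linarith
    have : 0 < (Real.sin α * Real.sin β * (r - s)) ^ 2 := by positivity
    linarith

theorem sin_nat_mul_pi_div {n : ℕ} (hn : 2 ≤ n) : Real.sin (n * (Real.pi / n)) = 0 := by
  rw [mul_div_cancel₀ _ (by positivity), Real.sin_pi]

theorem sin_pi_div_ne_zero {n : ℕ} (hn : 2 ≤ n) : Real.sin (Real.pi / n) ≠ 0 := by
  have hn' : (2 : ℝ) ≤ n := by exact_mod_cast hn
  refine (Real.sin_pos_of_pos_of_lt_pi (by positivity) ?_).ne'
  rw [div_lt_iff₀ (by positivity)]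
  nlinarith [Real.pi_pos]

theorem cos_pi_div_ne_zero {n : ℕ} (hn : 2 < n) : Real.cos (Real.pi / n) ≠ 0 := by
  have hn' : (2 : ℝ) < n := by exact_mod_cast hn
  refine (Real.cos_pos_of_mem_Ioo ⟨?_, ?_⟩).ne'
  · have : 0 < Real.pi / n := by positivity
    linarith [Real.pi_pos]
  · exact div_lt_div_of_pos_left Real.pi_pos two_pos hn'

theorem two_mul_cos_sq_lt {θ : ℝ} (hθ : Real.sin θ ≠ 0) : (2 * Real.cos θ) ^ 2 < 4 := by
  have := Real.sin_sq_add_cos_sq θ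
  have : 0 < Real.sin θ ^ 2 := by positivity
  linarith

/-- If `1/p + 1/q + 1/r < 1` then the triangle group `T_{p,q,r}` contains a
non-abelian free subgroup. -/
theorem stmt_17 (p q r : ℕ) (hp : 2 ≤ p) (hq : 2 ≤ q) (hr : 2 ≤ r)
    (h : (1 : ℚ) / p + 1 / q + 1 / r < 1) :
    ∃ f : FreeGroup (Fin 2) →* PresentedGroup (relsTriangle p q r),
      Function.Injective f := by
  have hangle : Real.pi / p + Real.pi / q + Real.pi / r < Real.pi := by
    have h' : (1 : ℝ) / p + 1 / q + 1 / r < 1 := by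
      have h'' := (Rat.cast_lt (K := ℝ)).2 h
      push_cast at h''
      exact h''
    calc Real.pi / p + Real.pi / q + Real.pi / r = Real.pi * (1 / p + 1 / q + 1 / r) := by ring
      _ < Real.pi * 1 := mul_lt_mul_of_pos_left h' Real.pi_pos
      _ = Real.pi := mul_one _
  have hpos : ∀ {n : ℕ}, 2 ≤ n → 0 < Real.pi / n := fun hn =>
    div_pos Real.pi_pos (Nat.cast_pos.2 (by omega))
  obtain ⟨A, B, hA, hB, hAB, hcomm⟩ := exists_triangle_matrices (hpos hp) (hpos hq) (hpos hr) hangle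
  have hAp := pow_mem_center_of_trace_eq hA (sin_pi_div_ne_zero hp) (sin_nat_mul_pi_div hp)
  have hBq := pow_mem_center_of_trace_eq hB (sin_pi_div_ne_zero hq) (sin_nat_mul_pi_div hq)
  have hABr : (A * B) ^ r ∈ Subgroup.center _ := by
    refine pow_mem_center_of_trace_eq (θ := Real.pi - Real.pi / r) ?_ ?_ ?_
    · rw [hAB, Real.cos_pi_sub]; ring
    · rw [Real.sin_pi_sub]
      exact sin_pi_div_ne_zero hr
    · rw [mul_sub, Real.sin_sub, Real.sin_nat_mul_pi, sin_nat_mul_pi_div hr]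
      ring
  let π : Matrix.SpecialLinearGroup (Fin 2) ℝ →*
      Matrix.SpecialLinearGroup (Fin 2) ℝ ⧸ Subgroup.center _ := QuotientGroup.mk' _
  have hπ : ∀ {C}, C ∈ Subgroup.center (Matrix.SpecialLinearGroup (Fin 2) ℝ) → π C = 1 :=
    fun hC => (QuotientGroup.eq_one_iff _).2 hC
  have hrels : ∀ w ∈ relsTriangle p q r, FreeGroup.lift ![π A, π B⁻¹] w = 1 := by
    rintro w (rfl | rfl | rfl)
    · simpa using hπ hAp
    · simpa using hπ hBq
    · simpa using hπ hABr
  let φ := PresentedGroup.toGroup hrels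
  have hx : φ (PresentedGroup.of 0) = π A := PresentedGroup.toGroup.of hrels
  have hy : φ (PresentedGroup.of 1)⁻¹ = π B := by
    rw [map_inv, inv_eq_iff_eq_inv, ← map_inv]
    exact PresentedGroup.toGroup.of hrels
  by_cases hp2 : p = 2
  · have hq2 : 2 < q := by
      refine lt_of_le_of_ne hq fun hq2 => ?_
      subst hp2 hq2
      have : (0 : ℚ) < 1 / r := by positivity
      norm_num at h this
      linarith
    refine exists_injective_of_trace_commutator φ hy hx ?_ ?_ ?_
    · rwa [← commutatorElement_inv, trace_inv_eq]
    · rw [hB]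
      exact mul_ne_zero two_ne_zero (cos_pi_div_ne_zero hq2)
    · rw [hB]
      exact two_mul_cos_sq_lt (sin_pi_div_ne_zero hq)
  · refine exists_injective_of_trace_commutator φ hx hy hcomm ?_ ?_
    · rw [hA]
      exact mul_ne_zero two_ne_zero (cos_pi_div_ne_zero (by omega))
    · rw [hA]
      exact two_mul_cos_sq_lt (sin_pi_div_ne_zero hp)
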